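/- arXiv:2402.10049 — 2 statements merged into one kernel-verified Lean document; each statement's English description precedes it below -/
import Mathlib

section
/- Let g : ℝ → ℝ be a differentiable function with g(0) = 0 and g'(0) = 1, and let x ∈ ℝ satisfy g(x) ≠ 0. Then, as s tends to 0 through nonzero values, (1/g(s))·( 1/g(x−s) − 1/g(x+s) ) tends to 2·g'(x)/g(x)². -/
open Topology Filter

/-- Limit of the combination of summands 1 and 10 (resp. 4 and 7) as `s → 0`, `s ≠ 0`. -/
theorem statement11 (g : ℝ → ℝ) (hg : Differentiable ℝ g)
    (h0 : g 0 = 0) (h1 : deriv g 0 = 1) (x : ℝ) (hx : g x ≠ 0) :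
    Tendsto (fun s : ℝ => (1 / g s) * (1 / g (x - s) - 1 / g (x + s)))
      (𝓝[≠] 0) (𝓝 (2 * deriv g x / g x ^ 2)) := by
  have hg0 : Tendsto (slope g 0) (𝓝[≠] 0) (𝓝 1) :=
    h1 ▸ hasDerivAt_iff_tendsto_slope.mp (hg 0).hasDerivAt
  have hsub : HasDerivAt (fun s : ℝ => g (x - s)) (-deriv g x) 0 := by
    simpa using HasDerivAt.comp_const_sub x 0 (by simpa using (hg x).hasDerivAt)
  have hadd : HasDerivAt (fun s : ℝ => g (x + s)) (deriv g x) 0 :=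
    HasDerivAt.comp_const_add x 0 (by simpa using (hg x).hasDerivAt)
  have hdiff := (hsub.fun_inv (by simpa using hx)).fun_sub (hadd.fun_inv (by simpa using hx))
  have hquot := (hasDerivAt_iff_tendsto_slope.mp hdiff).div hg0 one_ne_zero
  have hlim : (- -deriv g x / g (x - 0) ^ 2 - -deriv g x / g (x + 0) ^ 2) / 1 =
      2 * deriv g x / g x ^ 2 := by
    simp only [sub_zero, add_zero]
    ring
  rw [hlim] at hquot
  refine hquot.congr' ?_
  filter_upwards [self_mem_nhdsWithin] with s hs
  have hs : s ≠ 0 := hs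
  simp only [Pi.div_apply, slope_def_field, sub_zero, add_zero, h0, sub_self, one_div]
  rw [div_div_div_cancel_right₀ hs, div_eq_inv_mul]
end

section
/- Let g : ℝ → ℝ be a real-analytic odd function (g(−u) = −g(u) for all u) with g(0) = 0 and g'(0) = 1, and let c ∈ ℝ. Suppose there exists r > 0 such that for all y, z with 0 < |y| < r, 0 < |z| < r, y + z ≠ 0, the identity 2c = −2·g'(z)/(g(y+z)²·g(z)³) − 2·g'(y)/(g(y+z)²·g(y)³) − g''(z)/(g(y)·g(y+z)·g(z)²) − g''(y)/(g(z)·g(y+z)·g(y)²) + 2·g'(z)²/(g(y+z)·g(y)·g(z)³) + 2·g'(y)²/(g(y+z)·g(z)·g(y)³) − 2·g'(z)·g'(y)/(g(z)²·g(y+z)·g(y)²) holds. Then c = 0 and there exist δ, ε ∈ ℝ and ρ > 0 such that g'(u)² = 1 − 2δ·g(u)² + ε·g(u)⁴ for all u with |u| < ρ. -/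
open Topology Filter

theorem deriv_even_of_odd {f : ℝ → ℝ} (hf : ∀ u, f (-u) = -f u) (u : ℝ) :
    deriv f (-u) = deriv f u := by
  have h := deriv_comp_neg (f := f) u
  rw [show (fun x => f (-x)) = fun x => -f x from funext hf, deriv.fun_neg] at h
  linarith

theorem deriv_odd_of_even {f : ℝ → ℝ} (hf : ∀ u, f (-u) = f u) (u : ℝ) :
    deriv f (-u) = -deriv f u := by
  have h := deriv_comp_neg (f := f) u
  rw [show (fun x => f (-x)) = f from funext hf] at h
  linarith

theorem eventually_eq_zero_of_hasDerivAt {W W' : ℝ → ℝ} {x : ℝ}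
    (hW : ∀ᶠ z in 𝓝 x, W z = 0) (hd : ∀ᶠ z in 𝓝 x, HasDerivAt W (W' z) z) :
    ∀ᶠ z in 𝓝 x, W' z = 0 := by
  filter_upwards [hW.eventually_nhds, hd] with z hz hdz
  have hz' : W =ᶠ[𝓝 z] fun _ => 0 := hz
  rw [← hdz.deriv, hz'.deriv_eq, deriv_const]

theorem AnalyticAt.eventually_hasDerivAt {f : ℝ → ℝ} {x : ℝ} (hf : AnalyticAt ℝ f x) :
    ∀ᶠ z in 𝓝 x, HasDerivAt f (deriv f z) z :=
  hf.eventually_analyticAt.mono fun _ hz => hz.differentiableAt.hasDerivAt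

/-- If `g F' = n g' F` near `0`, then `F` is a constant multiple of `g ^ n` near `0`. -/
theorem exists_eventuallyEq_const_mul_pow {F g : ℝ → ℝ} (hF : AnalyticAt ℝ F 0)
    (hg : AnalyticAt ℝ g 0) (hne : ∀ᶠ u in 𝓝[≠] (0 : ℝ), g u ≠ 0) (n : ℕ)
    (h : ∀ᶠ u in 𝓝[≠] (0 : ℝ), g u * deriv F u = n * deriv g u * F u) :
    ∃ k : ℝ, ∀ᶠ u in 𝓝 (0 : ℝ), F u = k * g u ^ n := by
  have hev := (eventually_nhdsWithin_iff.1 hne).and ((eventually_nhdsWithin_iff.1 h).and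
    (hF.eventually_hasDerivAt.and hg.eventually_hasDerivAt))
  obtain ⟨ρ, hρ, hball⟩ := Metric.eventually_nhds_iff.1 hev
  have key : ∀ u ∈ Set.Ioo 0 ρ, g u ≠ 0 ∧ HasDerivAt (fun u => F u / g u ^ n) 0 u := by
    intro u hu
    obtain ⟨ha, hb, hFd, hgd⟩ := @hball u (by simpa [abs_of_pos hu.1] using hu.2)
    have hu0 : u ∈ ({0}ᶜ : Set ℝ) := by simpa using hu.1.ne'
    have hgu := ha hu0
    refine ⟨hgu, (hFd.fun_div (hgd.fun_pow n) (pow_ne_zero n hgu)).congr_deriv ?_⟩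
    rw [div_eq_zero_iff]
    left
    rcases n with _ | n
    · have := hb hu0
      simp_all
    · have := hb hu0
      simp only [Nat.add_sub_cancel]
      rw [pow_succ]
      linear_combination g u ^ n * this
  have hconst : ∀ u ∈ Set.Ioo 0 ρ, F u / g u ^ n = F (ρ / 2) / g (ρ / 2) ^ n := by
    intro u hu
    refine isOpen_Ioo.is_const_of_deriv_eq_zero isPreconnected_Ioo
      (fun v hv => (key v hv).2.differentiableAt.differentiableWithinAt)
      (fun v hv => (key v hv).2.deriv) hu ⟨by linarith, by linarith⟩
  refine ⟨F (ρ / 2) / g (ρ / 2) ^ n, ?_⟩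
  refine (hF.frequently_eq_iff_eventually_eq (analyticAt_const.mul (hg.pow n))).1 ?_
  have hfr : ∃ᶠ u in 𝓝[>] (0 : ℝ), F u = F (ρ / 2) / g (ρ / 2) ^ n * g u ^ n := by
    refine Eventually.frequently ?_
    filter_upwards [Ioo_mem_nhdsGT hρ] with u hu
    rw [← hconst u hu, div_mul_cancel₀ _ (pow_ne_zero n (key u hu).1)]
  exact hfr.filter_mono (nhdsWithin_mono 0 fun u hu => ne_of_gt hu)

/-- The third-order coefficient in `z` of the identity with cleared denominators. -/
theorem third_order_ode {b b₁ b₂ b₃ b₄ b₅ G G₁ G₂ G₃ : ℝ → ℝ} {a a₁ a₂ c : ℝ}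
    (hb : ∀ᶠ z in 𝓝 (0 : ℝ), HasDerivAt b (b₁ z) z)
    (hb₁ : ∀ᶠ z in 𝓝 (0 : ℝ), HasDerivAt b₁ (b₂ z) z)
    (hb₂ : ∀ᶠ z in 𝓝 (0 : ℝ), HasDerivAt b₂ (b₃ z) z)
    (hb₃ : ∀ᶠ z in 𝓝 (0 : ℝ), HasDerivAt b₃ (b₄ z) z)
    (hb₄ : ∀ᶠ z in 𝓝 (0 : ℝ), HasDerivAt b₄ (b₅ z) z)
    (hG : ∀ᶠ z in 𝓝 (0 : ℝ), HasDerivAt G (G₁ z) z)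
    (hG₁ : ∀ᶠ z in 𝓝 (0 : ℝ), HasDerivAt G₁ (G₂ z) z)
    (hG₂ : ∀ᶠ z in 𝓝 (0 : ℝ), HasDerivAt G₂ (G₃ z) z)
    (h0 : b 0 = 0) (h1 : b₁ 0 = 1) (h2 : b₂ 0 = 0) (h4 : b₄ 0 = 0)
    (hG0 : G 0 = a) (hG10 : G₁ 0 = a₁) (hG20 : G₂ 0 = a₂)
    (hW : ∀ᶠ z in 𝓝 (0 : ℝ),
      G z * (-(a ^ 2 * (b z * b₂ z)) + (2 * a₁ ^ 2 - a * a₂) * b z ^ 2 + 2 * a ^ 2 * b₁ z ^ 2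
        - 2 * a * a₁ * (b z * b₁ z)) - 2 * a ^ 3 * b₁ z - 2 * a₁ * b z ^ 3
        - 2 * c * a ^ 3 * (G z ^ 2 * b z ^ 3) = 0) :
    a ^ 2 * G₃ 0 - 6 * a * a₁ * a₂ + 6 * a₁ ^ 3 - 6 * a₁ - b₃ 0 * a ^ 2 * a₁ = 6 * c * a ^ 5 := by
  have hE : ∀ᶠ z in 𝓝 (0 : ℝ), HasDerivAt
      (fun z => -(a ^ 2 * (b z * b₂ z)) + (2 * a₁ ^ 2 - a * a₂) * b z ^ 2 + 2 * a ^ 2 * b₁ z ^ 2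
        - 2 * a * a₁ * (b z * b₁ z))
      (3 * a ^ 2 * (b₁ z * b₂ z) - a ^ 2 * (b z * b₃ z) + 2 * (2 * a₁ ^ 2 - a * a₂) * (b z * b₁ z)
        - 2 * a * a₁ * (b₁ z ^ 2 + b z * b₂ z)) z := by
    filter_upwards [hb, hb₁, hb₂] with z d0 d1 d2
    exact (((((d0.fun_mul d2).const_mul (a ^ 2)).fun_neg.fun_add
      ((d0.fun_pow 2).const_mul (2 * a₁ ^ 2 - a * a₂))).fun_add
      ((d1.fun_pow 2).const_mul (2 * a ^ 2))).fun_sub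
      ((d0.fun_mul d1).const_mul (2 * a * a₁))).congr_deriv (by push_cast; ring)
  have hE' : ∀ᶠ z in 𝓝 (0 : ℝ), HasDerivAt
      (fun z => 3 * a ^ 2 * (b₁ z * b₂ z) - a ^ 2 * (b z * b₃ z)
        + 2 * (2 * a₁ ^ 2 - a * a₂) * (b z * b₁ z) - 2 * a * a₁ * (b₁ z ^ 2 + b z * b₂ z))
      (3 * a ^ 2 * b₂ z ^ 2 + 2 * a ^ 2 * (b₁ z * b₃ z) - a ^ 2 * (b z * b₄ z)
        + 2 * (2 * a₁ ^ 2 - a * a₂) * (b₁ z ^ 2 + b z * b₂ z)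
        - 2 * a * a₁ * (3 * (b₁ z * b₂ z) + b z * b₃ z)) z := by
    filter_upwards [hb, hb₁, hb₂, hb₃] with z d0 d1 d2 d3
    exact (((((d1.fun_mul d2).const_mul (3 * a ^ 2)).fun_sub
      ((d0.fun_mul d3).const_mul (a ^ 2))).fun_add
      ((d0.fun_mul d1).const_mul (2 * (2 * a₁ ^ 2 - a * a₂)))).fun_sub
      (((d1.fun_pow 2).fun_add (d0.fun_mul d2)).const_mul (2 * a * a₁))).congr_deriv
        (by push_cast; ring)
  have hE'' : ∀ᶠ z in 𝓝 (0 : ℝ), HasDerivAt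
      (fun z => 3 * a ^ 2 * b₂ z ^ 2 + 2 * a ^ 2 * (b₁ z * b₃ z) - a ^ 2 * (b z * b₄ z)
        + 2 * (2 * a₁ ^ 2 - a * a₂) * (b₁ z ^ 2 + b z * b₂ z)
        - 2 * a * a₁ * (3 * (b₁ z * b₂ z) + b z * b₃ z))
      (8 * a ^ 2 * (b₂ z * b₃ z) + a ^ 2 * (b₁ z * b₄ z) - a ^ 2 * (b z * b₅ z)
        + 2 * (2 * a₁ ^ 2 - a * a₂) * (3 * (b₁ z * b₂ z) + b z * b₃ z)
        - 2 * a * a₁ * (3 * b₂ z ^ 2 + 4 * (b₁ z * b₃ z) + b z * b₄ z)) z := by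
    filter_upwards [hb, hb₁, hb₂, hb₃, hb₄] with z d0 d1 d2 d3 d4
    exact ((((((d2.fun_pow 2).const_mul (3 * a ^ 2)).fun_add
      ((d1.fun_mul d3).const_mul (2 * a ^ 2))).fun_sub
      ((d0.fun_mul d4).const_mul (a ^ 2))).fun_add
      (((d1.fun_pow 2).fun_add (d0.fun_mul d2)).const_mul (2 * (2 * a₁ ^ 2 - a * a₂)))).fun_sub
      ((((d1.fun_mul d2).const_mul 3).fun_add (d0.fun_mul d3)).const_mul (2 * a * a₁))).congr_deriv
        (by push_cast; ring)
  have hT : ∀ᶠ z in 𝓝 (0 : ℝ), HasDerivAt (fun z => G z ^ 2 * b z ^ 3)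
      (2 * (G z * G₁ z) * b z ^ 3 + 3 * (G z ^ 2 * b₁ z) * b z ^ 2) z := by
    filter_upwards [hb, hG] with z d0 e0
    exact ((e0.fun_pow 2).fun_mul (d0.fun_pow 3)).congr_deriv (by push_cast; ring)
  have hT' : ∀ᶠ z in 𝓝 (0 : ℝ), HasDerivAt
      (fun z => 2 * (G z * G₁ z) * b z ^ 3 + 3 * (G z ^ 2 * b₁ z) * b z ^ 2)
      (2 * (G₁ z ^ 2 + G z * G₂ z) * b z ^ 3
        + (12 * (G z * G₁ z * b₁ z) + 3 * (G z ^ 2 * b₂ z)) * b z ^ 2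
        + 6 * (G z * b₁ z) ^ 2 * b z) z := by
    filter_upwards [hb, hb₁, hG, hG₁] with z d0 d1 e0 e1
    exact ((((e0.fun_mul e1).const_mul 2).fun_mul (d0.fun_pow 3)).fun_add
      ((((e0.fun_pow 2).fun_mul d1).const_mul 3).fun_mul (d0.fun_pow 2))).congr_deriv
      (by push_cast; ring)
  have hT'' : HasDerivAt
      (fun z => 2 * (G₁ z ^ 2 + G z * G₂ z) * b z ^ 3
        + (12 * (G z * G₁ z * b₁ z) + 3 * (G z ^ 2 * b₂ z)) * b z ^ 2
        + 6 * (G z * b₁ z) ^ 2 * b z) (6 * a ^ 2) 0 := by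
    have d0 := hb.self_of_nhds
    have d1 := hb₁.self_of_nhds
    have d2 := hb₂.self_of_nhds
    have e0 := hG.self_of_nhds
    have e1 := hG₁.self_of_nhds
    have e2 := hG₂.self_of_nhds
    exact ((((((e1.fun_pow 2).fun_add (e0.fun_mul e2)).const_mul 2).fun_mul
      (d0.fun_pow 3)).fun_add ((((((e0.fun_mul e1).fun_mul d1).const_mul 12).fun_add
      (((e0.fun_pow 2).fun_mul d2).const_mul 3))).fun_mul (d0.fun_pow 2))).fun_add
      ((((e0.fun_mul d1).fun_pow 2).const_mul 6).fun_mul d0)).congr_deriv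
      (by simp [h0, h1, hG0])
  have hS : ∀ᶠ z in 𝓝 (0 : ℝ), HasDerivAt (fun z => b z ^ 3) (3 * (b z ^ 2 * b₁ z)) z := by
    filter_upwards [hb] with z d0
    exact (d0.fun_pow 3).congr_deriv (by push_cast; ring)
  have hS' : ∀ᶠ z in 𝓝 (0 : ℝ), HasDerivAt (fun z => 3 * (b z ^ 2 * b₁ z))
      (6 * (b z * b₁ z ^ 2) + 3 * (b z ^ 2 * b₂ z)) z := by
    filter_upwards [hb, hb₁] with z d0 d1
    exact (((d0.fun_pow 2).fun_mul d1).const_mul 3).congr_deriv (by push_cast; ring)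
  have hS'' : HasDerivAt (fun z => 6 * (b z * b₁ z ^ 2) + 3 * (b z ^ 2 * b₂ z)) 6 0 := by
    have d0 := hb.self_of_nhds
    have d1 := hb₁.self_of_nhds
    have d2 := hb₂.self_of_nhds
    exact (((d0.fun_mul (d1.fun_pow 2)).const_mul 6).fun_add
      (((d0.fun_pow 2).fun_mul d2).const_mul 3)).congr_deriv (by simp [h0, h1])
  have hW₁ := eventually_eq_zero_of_hasDerivAt hW <| by
    filter_upwards [hG, hE, hb₁, hS, hT] with z e0 dE d1 dS dT
    exact (((e0.fun_mul dE).fun_sub (d1.const_mul (2 * a ^ 3))).fun_sub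
      (dS.const_mul (2 * a₁))).fun_sub (dT.const_mul (2 * c * a ^ 3))
  have hW₂ := eventually_eq_zero_of_hasDerivAt hW₁ <| by
    filter_upwards [hG, hG₁, hE, hE', hb₂, hS', hT'] with z e0 e1 dE dE' d2 dS dT
    exact ((((e1.fun_mul dE).fun_add (e0.fun_mul dE')).fun_sub
      (d2.const_mul (2 * a ^ 3))).fun_sub (dS.const_mul (2 * a₁))).fun_sub
      (dT.const_mul (2 * c * a ^ 3))
  have hW₃ := (((((hG₂.self_of_nhds.fun_mul hE.self_of_nhds).fun_add
      (hG₁.self_of_nhds.fun_mul hE'.self_of_nhds)).fun_add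
      ((hG₁.self_of_nhds.fun_mul hE'.self_of_nhds).fun_add
      (hG.self_of_nhds.fun_mul hE''.self_of_nhds))).fun_sub
      (hb₃.self_of_nhds.const_mul (2 * a ^ 3))).fun_sub (hS''.const_mul (2 * a₁))).fun_sub
      (hT''.const_mul (2 * c * a ^ 3))
  have hzero := hW₃.unique ((hasDerivAt_const (0 : ℝ) (0 : ℝ)).congr_of_eventuallyEq hW₂)
  simp only [h0, h1, h2, h4, hG0, hG10, hG20] at hzero
  linear_combination hzero / 2

/-- If `g` is a real-analytic odd function with `g(0) = 0`, `g'(0) = 1` satisfying the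
symmetrised rigidity identity for all small nonzero `y`, `z` with `y + z ≠ 0`, then
`c = 0` and `g` satisfies the differential equation of the elliptic sine near `0`. -/
theorem statement13 (g : ℝ → ℝ) (han : AnalyticAt ℝ g 0)
    (hodd : ∀ u : ℝ, g (-u) = -g u)
    (h0 : g 0 = 0) (h1 : deriv g 0 = 1) (c : ℝ)
    (h : ∃ r : ℝ, 0 < r ∧ ∀ y z : ℝ, 0 < |y| → |y| < r → 0 < |z| → |z| < r → y + z ≠ 0 →
      2 * c =
        -(2 * deriv g z / (g (y + z) ^ 2 * g z ^ 3))
        - 2 * deriv g y / (g (y + z) ^ 2 * g y ^ 3)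
        - deriv (deriv g) z / (g y * g (y + z) * g z ^ 2)
        - deriv (deriv g) y / (g z * g (y + z) * g y ^ 2)
        + 2 * (deriv g z) ^ 2 / (g (y + z) * g y * g z ^ 3)
        + 2 * (deriv g y) ^ 2 / (g (y + z) * g z * g y ^ 3)
        - 2 * deriv g z * deriv g y / (g z ^ 2 * g (y + z) * g y ^ 2)) :
    c = 0 ∧ ∃ δ ε ρ : ℝ, 0 < ρ ∧ ∀ u : ℝ, |u| < ρ →
      (deriv g u) ^ 2 = 1 - 2 * δ * g u ^ 2 + ε * g u ^ 4 := by
  obtain ⟨r, hr, h⟩ := h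
  have p1 := deriv_even_of_odd hodd
  have p2 := deriv_odd_of_even p1
  have p3 := deriv_even_of_odd p2
  have p4 := deriv_odd_of_even p3
  have h2 : deriv (deriv g) 0 = 0 := by
    have := p2 0
    rw [neg_zero] at this
    linarith
  have h4 : deriv (deriv (deriv (deriv g))) 0 = 0 := by
    have := p4 0
    rw [neg_zero] at this
    linarith
  have hne : ∀ᶠ u in 𝓝[≠] (0 : ℝ), g u ≠ 0 :=
    han.differentiableAt.hasDerivAt.eventually_ne (by rw [h1]; exact one_ne_zero)
  have hode : ∀ᶠ y in 𝓝[≠] (0 : ℝ),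
      g y ^ 2 * deriv (deriv (deriv g)) y - 6 * g y * deriv g y * deriv (deriv g) y
        + 6 * deriv g y ^ 3 - 6 * deriv g y
        - deriv (deriv (deriv g)) 0 * g y ^ 2 * deriv g y = 6 * c * g y ^ 5 := by
    rw [eventually_nhdsWithin_iff]
    have hr' : ∀ᶠ y in 𝓝 (0 : ℝ), |y| < r := by
      filter_upwards [Metric.ball_mem_nhds (0 : ℝ) hr] with y hy
      simpa using hy
    filter_upwards [(eventually_nhdsWithin_iff.1 hne).eventually_nhds, hr',
      han.eventually_analyticAt] with y hgy hyr hay hy0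
    have hy0' : y ≠ 0 := hy0
    have hgy0 : g y ≠ 0 := hgy.self_of_nhds hy0
    have hshift : Tendsto (fun z => y + z) (𝓝 0) (𝓝 y) := by
      simpa using (continuous_const_add y).tendsto 0
    have hder : ∀ {f : ℝ → ℝ}, AnalyticAt ℝ f y →
        ∀ᶠ z in 𝓝 (0 : ℝ), HasDerivAt (fun z => f (y + z)) (deriv f (y + z)) z := by
      intro f hf
      filter_upwards [hshift.eventually hf.eventually_hasDerivAt] with z hz
      exact hz.comp_const_add y z
    have key := third_order_ode (c := c) (a := g y) (a₁ := deriv g y) (a₂ := deriv (deriv g) y)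
      han.eventually_hasDerivAt han.deriv.eventually_hasDerivAt
      han.deriv.deriv.eventually_hasDerivAt han.deriv.deriv.deriv.eventually_hasDerivAt
      han.deriv.deriv.deriv.deriv.eventually_hasDerivAt
      (hder hay) (hder hay.deriv) (hder hay.deriv.deriv) h0 h1 h2 h4
      (by simp) (by simp) (by simp) ?_
    · simpa using key
    · filter_upwards [hr', eventually_nhdsWithin_iff.1 hne, hshift.eventually hgy,
        hshift.eventually (eventually_ne_nhds hy0')] with z hzr hgz hgyz hyz
      by_cases hz : z = 0
      · subst hz
        simp only [h0, h1, add_zero]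
        ring
      · have hid := h y z (abs_pos.2 hy0') hyr (abs_pos.2 hz) hzr hyz
        have hz1 := hgz hz
        have hz2 := hgyz hyz
        field_simp at hid
        linear_combination -hid
  have hneg : Tendsto (fun u : ℝ => -u) (𝓝[≠] 0) (𝓝[≠] 0) := by
    refine tendsto_nhdsWithin_iff.2 ⟨?_, ?_⟩
    · simpa using (continuous_neg.tendsto (0 : ℝ)).mono_left nhdsWithin_le_nhds
    · filter_upwards [self_mem_nhdsWithin] with u hu
      simpa using hu
  have hc : c = 0 := by
    obtain ⟨y, hy, hy', hgy⟩ := (hode.and ((hneg.eventually hode).and hne)).exists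
    rw [hodd, p1, p2, p3] at hy'
    have : c * g y ^ 5 = 0 := by linear_combination (hy' - hy) / 12
    exact (mul_eq_zero.1 this).resolve_right (pow_ne_zero 5 hgy)
  subst hc
  refine ⟨rfl, ?_⟩
  set κ := deriv (deriv (deriv g)) 0
  have hd := han.eventually_hasDerivAt
  have hd₁ := han.deriv.eventually_hasDerivAt
  have hd₂ := han.deriv.deriv.eventually_hasDerivAt
  have hN0 : ∀ᶠ u in 𝓝 (0 : ℝ),
      2 * (g u * deriv (deriv g) u) + 2 * κ * g u ^ 2 - 4 * deriv g u ^ 2 + 4 = 0 := by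
    have hNan : AnalyticAt ℝ (fun u =>
        2 * (g u * deriv (deriv g) u) + 2 * κ * g u ^ 2 - 4 * deriv g u ^ 2 + 4) 0 := by
      have := han.deriv
      have := han.deriv.deriv
      fun_prop
    obtain ⟨k, hk⟩ := exists_eventuallyEq_const_mul_pow hNan han hne 3 <| by
      filter_upwards [hode, nhdsWithin_le_nhds hd, nhdsWithin_le_nhds hd₁,
        nhdsWithin_le_nhds hd₂] with u hu d0 d1 d2
      rw [((((d0.fun_mul d2).const_mul 2).fun_add ((d0.fun_pow 2).const_mul (2 * κ))).fun_sub
        ((d1.fun_pow 2).const_mul 4)).add_const 4 |>.deriv]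
      push_cast
      linear_combination 2 * hu
    have hneg' : Tendsto (fun u : ℝ => -u) (𝓝 0) (𝓝 0) := by
      simpa using continuous_neg.tendsto (0 : ℝ)
    filter_upwards [hk, hneg'.eventually hk] with u hu hu'
    rw [hodd, p1, p2] at hu'
    linear_combination (hu + hu') / 2
  have hPan : AnalyticAt ℝ (fun u => deriv g u ^ 2 - 1 - κ * g u ^ 2) 0 := by
    have := han.deriv
    fun_prop
  obtain ⟨ε, hε⟩ := exists_eventuallyEq_const_mul_pow hPan han hne 4 <| by
    filter_upwards [nhdsWithin_le_nhds hN0, nhdsWithin_le_nhds hd,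
      nhdsWithin_le_nhds hd₁] with u hu d0 d1
    rw [(((d1.fun_pow 2).sub_const 1).fun_sub ((d0.fun_pow 2).const_mul κ)).deriv]
    push_cast
    linear_combination deriv g u * hu
  obtain ⟨ρ, hρ, hball⟩ := Metric.eventually_nhds_iff.1 hε
  refine ⟨-κ / 2, ε, ρ, hρ, fun u hu => ?_⟩
  have := @hball u (by simpa using hu)
  linear_combination this
end
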